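/- Let S be a nonempty finite set of positive integers, let k ≥ 1, and let m ≥ 1 be odd, with n = k·m. Then the quadratic trace function Q_k(x) = Tr(∑_{i∈S} x^(2^i+1)) on GaloisField 2 k is balanced if and only if Q_n(x) = Tr(∑_{i∈S} x^(2^i+1)) on GaloisField 2 n is balanced. In particular, whether Q_n is balanced depends only on the 2-adic valuation of n. -/

import Mathlib

/-- The quadratic trace function `Q_n(x) = Tr(∑_{i∈S} x^(2^i+1))` on `GaloisField 2 n`. -/
noncomputable def Qtr (S : Finset ℕ) (n : ℕ) (x : GaloisField 2 n) : ZMod 2 :=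
  Algebra.trace (ZMod 2) (GaloisField 2 n) (∑ i ∈ S, x ^ (2 ^ i + 1))

/-- `g` is balanced if it takes the value `1` exactly `2^(n-1)` times. -/
noncomputable def BalancedG (n : ℕ) (g : GaloisField 2 n → ZMod 2) : Prop :=
  Nat.card {x : GaloisField 2 n // g x = 1} = 2 ^ (n - 1)

noncomputable def qq (S : Finset ℕ) (K : Type) [Field K] [Algebra (ZMod 2) K] (x : K) : ZMod 2 :=
  Algebra.trace (ZMod 2) K (∑ i ∈ S, x ^ (2 ^ i + 1))

noncomputable def bb (S : Finset ℕ) (K : Type) [Field K] [Algebra (ZMod 2) K] (x y : K) : ZMod 2 :=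
  Algebra.trace (ZMod 2) K (∑ i ∈ S, (x ^ (2 ^ i) * y + x * y ^ (2 ^ i)))

section gen
variable (S : Finset ℕ) {K : Type} [Field K] [Algebra (ZMod 2) K]

lemma charTwo_aux (K : Type) [Field K] [Algebra (ZMod 2) K] : CharP K 2 :=
  charP_of_injective_algebraMap (algebraMap (ZMod 2) K).injective 2

lemma qq_add (x y : K) : qq S K (x + y) = qq S K x + qq S K y + bb S K x y := by
  have := charTwo_aux K
  unfold qq bb
  rw [← map_add, ← map_add, ← Finset.sum_add_distrib, ← Finset.sum_add_distrib]
  congr 1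
  refine Finset.sum_congr rfl fun i _ => ?_
  rw [pow_succ, add_pow_char_pow]
  ring

lemma bb_comm (x y : K) : bb S K x y = bb S K y x := by
  unfold bb
  congr 1
  refine Finset.sum_congr rfl fun i _ => ?_
  ring

lemma bb_add (x y z : K) : bb S K x (y + z) = bb S K x y + bb S K x z := by
  have := charTwo_aux K
  unfold bb
  rw [← map_add, ← Finset.sum_add_distrib]
  congr 1
  refine Finset.sum_congr rfl fun i _ => ?_
  rw [add_pow_char_pow]
  ring

end gen

/-- the sign character -/
def sg (a : ZMod 2) : ℤ := if a = 0 then 1 else -1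

lemma sg_add : ∀ a b : ZMod 2, sg (a + b) = sg a * sg b := by decide

lemma sg_eq : ∀ a : ZMod 2, sg a = 1 - 2 * (if a = 1 then 1 else 0) := by decide

lemma zmod_two_aux : ∀ a : ZMod 2, a ≠ 0 → a = 1 := by decide

lemma zmod_two_self : ∀ a : ZMod 2, a + a = 0 := by decide

lemma sum_sg (V : Type) [AddCommGroup V] [Fintype V] (f : V → ZMod 2)
    (hf : ∀ x y, f (x + y) = f x + f y) (w : V) (hw : f w = 1) : ∑ x, sg (f x) = 0 := by
  have h : ∑ x, sg (f x) = ∑ x, sg (f (w + x)) :=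
    (Equiv.sum_comp (Equiv.addLeft w) (fun x => sg (f x))).symm
  simp only [hf, hw, sg_add] at h
  rw [← Finset.mul_sum] at h
  have : sg 1 = -1 := by decide
  rw [this] at h
  linarith

lemma balanced_aux (V : Type) [AddCommGroup V] [Fintype V] (q : V → ZMod 2) (b : V → V → ZMod 2)
    (hq : ∀ x y, q (x + y) = q x + q y + b x y) (hb : ∀ x y z, b x (y + z) = b x y + b x z) :
    2 * Nat.card {x // q x = 1} = Fintype.card V ↔ ∃ w, (∀ y, b w y = 0) ∧ q w = 1 := by
  classical
  have hs : ∑ x, sg (q x) = (Fintype.card V : ℤ) - 2 * (Nat.card {x // q x = 1} : ℤ) := by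
    simp only [sg_eq, Finset.sum_sub_distrib, ← Finset.mul_sum]
    simp [Fintype.card_subtype]
  have h0 : 2 * Nat.card {x // q x = 1} = Fintype.card V ↔ ∑ x, sg (q x) = 0 := by
    rw [hs]; omega
  rw [h0]
  constructor
  · intro h
    by_contra! hcon
    have h2 : ∑ y, ∑ x, sg (q y) * sg (b y x) = 0 := by
      have : ∀ y x, sg (q y) * sg (b y x) = sg (q (y + x)) * sg (q x) := by
        intro y x
        rw [← sg_add, ← sg_add, hq]
        congr 1
        have := zmod_two_self (q x)
        linear_combination -this
      simp only [this]
      rw [Finset.sum_comm]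
      have : ∀ x, ∑ y, sg (q (y + x)) * sg (q x) = 0 := by
        intro x
        have e : ∑ y, sg (q (y + x)) = ∑ y, sg (q y) :=
          Equiv.sum_comp (Equiv.addRight x) (fun y => sg (q y))
        rw [← Finset.sum_mul, e, h, zero_mul]
      simp [this]
    have hb0 : b 0 0 = 0 := by simpa using hb 0 0 0
    have hb00 : ∀ x, b 0 x = 0 := by
      intro x
      have h1 := hq 0 x
      have h2 := hq 0 0
      simp only [zero_add, hb0] at h1 h2
      have : q 0 = 0 := by simpa using h2
      rw [this] at h1
      simpa using h1
    have hnn : ∀ y, 0 ≤ ∑ x, sg (q y) * sg (b y x) := by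
      intro y
      rw [← Finset.mul_sum]
      by_cases hy : ∀ x, b y x = 0
      · have : q y = 0 := by
          by_contra h3
          exact hcon y hy (zmod_two_aux _ h3)
        simp [this, hy, sg]
      · push Not at hy
        obtain ⟨w, hw⟩ := hy
        rw [sum_sg V (b y) (hb y) w (zmod_two_aux _ hw)]
        simp
    have h3 := (Finset.sum_eq_zero_iff_of_nonneg (fun y _ => hnn y)).1 h2 0 (Finset.mem_univ _)
    have hq0 : q 0 = 0 := by
      have := hq 0 0
      simpa [hb0] using this
    simp [hq0, hb00, sg] at h3
  · rintro ⟨w, hw, hw1⟩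
    have h : ∑ x, sg (q x) = ∑ x, sg (q (w + x)) :=
      (Equiv.sum_comp (Equiv.addLeft w) (fun x => sg (q x))).symm
    simp only [hq, hw, hw1, sg_add] at h
    have e1 : sg 1 = -1 := by decide
    have e0 : sg 0 = 1 := by decide
    simp only [e1, e0, mul_one, neg_mul, one_mul, Finset.sum_neg_distrib] at h
    linarith

section tower
variable (S : Finset ℕ) {K F : Type} [Field K] [Algebra (ZMod 2) K] [Field F] [Algebra (ZMod 2) F]
  [Finite K] [Finite F] [Algebra K F] [IsScalarTower (ZMod 2) K F]

lemma trace_pow_aux (y : F) (i : ℕ) :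
    Algebra.trace K F (y ^ 2 ^ i) = (Algebra.trace K F y) ^ 2 ^ i := by
  have := charTwo_aux F
  apply (algebraMap K F).injective
  rw [map_pow (algebraMap K F), FiniteField.algebraMap_trace_eq_sum_pow, FiniteField.algebraMap_trace_eq_sum_pow,
    sum_pow_char_pow]
  refine Finset.sum_congr rfl fun j _ => ?_
  rw [← pow_mul, ← pow_mul, mul_comm]

lemma bb_tower (w : K) (y : F) :
    bb S F (algebraMap K F w) y = bb S K w (Algebra.trace K F y) := by
  unfold bb
  rw [← Algebra.trace_trace (S := K), map_sum]
  congr 1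
  refine Finset.sum_congr rfl fun i _ => ?_
  rw [map_add, ← map_pow, ← Algebra.smul_def, ← Algebra.smul_def, map_smul, map_smul,
    trace_pow_aux, smul_eq_mul, smul_eq_mul]

lemma qq_tower (hodd : Odd (Module.finrank K F)) (w : K) :
    qq S F (algebraMap K F w) = qq S K w := by
  unfold qq
  rw [← Algebra.trace_trace (S := K)]
  simp only [← map_pow, ← map_sum]
  rw [Algebra.trace_algebraMap, map_nsmul, nsmul_eq_mul]
  rw [(ZMod.natCast_eq_one_iff_odd).2 hodd, one_mul]

end tower

section frob
variable (S : Finset ℕ) {F : Type} [Field F] [Algebra (ZMod 2) F] [Finite F]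

lemma qq_frob (u : F) (t : ℕ) : qq S F (u ^ 2 ^ t) = qq S F u := by
  have := charTwo_aux F
  unfold qq
  have : ∑ i ∈ S, (u ^ 2 ^ t) ^ (2 ^ i + 1) = (∑ i ∈ S, u ^ (2 ^ i + 1)) ^ 2 ^ t := by
    rw [sum_pow_char_pow]
    refine Finset.sum_congr rfl fun j _ => ?_
    rw [← pow_mul, ← pow_mul, mul_comm]
  rw [this, trace_pow_aux]
  exact ZMod.pow_card_pow _

lemma bb_frob (u y : F) (t : ℕ) : bb S F (u ^ 2 ^ t) (y ^ 2 ^ t) = bb S F u y := by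
  have := charTwo_aux F
  have h1 := qq_add S (u ^ 2 ^ t) (y ^ 2 ^ t)
  rw [← add_pow_char_pow, qq_frob, qq_frob, qq_frob, qq_add] at h1
  exact (add_left_cancel h1).symm

lemma bb_frob_rad (u : F) (hu : ∀ y, bb S F u y = 0) (t : ℕ) (y : F) :
    bb S F (u ^ 2 ^ t) y = 0 := by
  have := charTwo_aux F
  have hinj : Function.Injective (fun z : F => z ^ 2 ^ t) := iterateFrobenius_inj F 2 t
  obtain ⟨z, rfl⟩ := (Finite.injective_iff_surjective.1 hinj) y
  rw [bb_frob, hu]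

lemma qq_sum (u : F) (hu : ∀ y, bb S F u y = 0) (a m : ℕ) :
    qq S F (∑ j ∈ Finset.range m, u ^ 2 ^ (a * j)) = m * qq S F u := by
  induction m with
  | zero => simp [qq]
  | succ m ih =>
    rw [Finset.sum_range_succ, qq_add, bb_comm, bb_frob_rad S u hu, ih, qq_frob]
    push_cast
    ring

end frob

lemma main_aux (S : Finset ℕ) (K F : Type) [Field K] [Algebra (ZMod 2) K] [Field F]
    [Algebra (ZMod 2) F] [Finite K] [Finite F] [Algebra K F] [IsScalarTower (ZMod 2) K F]
    (k : ℕ) (hK : Nat.card K = 2 ^ k) (hodd : Odd (Module.finrank K F)) :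
    (∃ w, (∀ y, bb S K w y = 0) ∧ qq S K w = 1) ↔ ∃ w, (∀ y, bb S F w y = 0) ∧ qq S F w = 1 := by
  constructor
  · rintro ⟨w, hw, hw1⟩
    refine ⟨algebraMap K F w, fun y => ?_, ?_⟩
    · rw [bb_tower, hw]
    · rw [qq_tower S hodd, hw1]
  · rintro ⟨u, hu, hu1⟩
    refine ⟨Algebra.trace K F u, fun y => ?_, ?_⟩
    · rw [bb_comm, ← bb_tower, bb_comm, hu]
    · rw [← qq_tower (F := F) S hodd, FiniteField.algebraMap_trace_eq_sum_pow]
      simp only [hK, ← pow_mul]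
      rw [qq_sum S u hu, hu1, (ZMod.natCast_eq_one_iff_odd).2 hodd, one_mul]

lemma balanced_iff_aux (S : Finset ℕ) (n : ℕ) (hn : n ≠ 0) :
    BalancedG n (Qtr S n) ↔ ∃ w, (∀ y, bb S (GaloisField 2 n) w y = 0) ∧
      qq S (GaloisField 2 n) w = 1 := by
  have := Fintype.ofFinite (GaloisField 2 n)
  rw [← balanced_aux (GaloisField 2 n) _ _ (qq_add S) (bb_add S), ← Nat.card_eq_fintype_card,
    GaloisField.card 2 n hn]
  obtain ⟨n, rfl⟩ := Nat.exists_eq_succ_of_ne_zero hn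
  unfold BalancedG
  change Nat.card {x // qq S _ x = 1} = _ ↔ _
  rw [Nat.succ_eq_add_one, Nat.add_sub_cancel, pow_succ']
  omega

/-- For `n = k·m` with `m` odd, `Q_k` is balanced iff `Q_n` is; in particular,
balancedness of `Q_n` depends only on the 2-adic valuation of `n`. -/
theorem balanced_iff_of_odd_factor (S : Finset ℕ) (hS : S.Nonempty)
    (hpos : ∀ i ∈ S, 1 ≤ i) (k m n : ℕ) (hk : 1 ≤ k) (hm : 1 ≤ m)
    (hmodd : Odd m) (hn : n = k * m) :
    BalancedG k (Qtr S k) ↔ BalancedG n (Qtr S n) := by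
  have hk0 : k ≠ 0 := by omega
  have hn0 : n ≠ 0 := by rw [hn]; exact Nat.mul_ne_zero hk0 (by omega)
  rw [balanced_iff_aux S k hk0, balanced_iff_aux S n hn0]
  obtain ⟨f⟩ : Nonempty (GaloisField 2 k →ₐ[ZMod 2] GaloisField 2 n) := by
    apply FiniteField.nonempty_algHom_of_finrank_dvd
    rw [GaloisField.finrank 2 hk0, GaloisField.finrank 2 hn0, hn]
    exact dvd_mul_right _ _
  letI : Algebra (GaloisField 2 k) (GaloisField 2 n) := f.toRingHom.toAlgebra
  have : IsScalarTower (ZMod 2) (GaloisField 2 k) (GaloisField 2 n) :=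
    IsScalarTower.of_algebraMap_eq fun x => (f.commutes x).symm
  refine main_aux S _ _ k (GaloisField.card 2 k hk0) ?_
  have h := Module.finrank_mul_finrank (ZMod 2) (GaloisField 2 k) (GaloisField 2 n)
  rw [GaloisField.finrank 2 hk0, GaloisField.finrank 2 hn0] at h
  rwa [Nat.eq_of_mul_eq_mul_left (by omega) (h.trans hn)]
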